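/- Let G be a connected 4-regular simple graph with n vertices. Then the subdivided double D(G) has at least 2^n distinct Hamiltonian cycles (Hamiltonian cycles being counted as distinct when their edge sets differ). -/

import Mathlib

open SimpleGraph

/-- The subdivided double `D(G)` of a simple graph `G`: vertices are the twin vertices
`(v, i)` for `v : V`, `i : Bool`, together with the subdivision vertices (edges of `G`);
a twin vertex `(v, i)` is adjacent to a subdivision vertex `e` iff `v` is an endpoint of `e`. -/
def subdividedDouble {V : Type*} (G : SimpleGraph V) :
    SimpleGraph ((V × Bool) ⊕ ↥G.edgeSet) :=
  SimpleGraph.fromRel fun x y =>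
    ∃ (v : V) (i : Bool) (e : G.edgeSet),
      x = Sum.inl (v, i) ∧ y = Sum.inr e ∧ v ∈ (e : Sym2 V)

namespace SimpleGraph

namespace Walk

variable {V : Type*} {G : SimpleGraph V} [DecidableEq V]

/-- Every occurrence of `x` along a walk uses two incident edges, up to the two ends. -/
theorem countP_mem_edges_add {u v : V} (p : G.Walk u v) (x : V) :
    p.edges.countP (fun e => x ∈ e) + (if x = v then 1 else 0) =
      2 * p.support.tail.count x + (if x = u then 1 else 0) := by
  induction p with
  | nil => simp
  | @cons u v w h p ih =>
    have hne := h.ne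
    rw [support_cons, List.tail_cons, ← cons_tail_support, List.count_cons, edges_cons,
      List.countP_cons]
    simp only [Sym2.mem_iff, decide_eq_true_eq, beq_iff_eq]
    grind

/-- A trail containing all edges at `x` traverses exactly `deg x` edges at `x`. -/
theorem IsTrail.countP_mem_edges_eq_degree {u v : V} {p : G.Walk u v} (hp : p.IsTrail) (x : V)
    [Fintype (G.neighborSet x)] (hx : ∀ w, G.Adj x w → s(x, w) ∈ p.edges) :
    p.edges.countP (fun e => x ∈ e) = G.degree x := by
  rw [← card_incidenceFinset_eq_degree, List.countP_eq_length_filter,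
    ← List.toFinset_card_of_nodup (hp.edges_nodup.filter _)]
  congr 1
  ext e
  simp only [List.mem_toFinset, List.mem_filter, decide_eq_true_eq, mem_incidenceFinset,
    incidenceSet, Set.mem_sep_iff]
  refine ⟨fun h => ⟨p.edges_subset_edgeSet h.1, h.2⟩, fun h => ⟨?_, h.2⟩⟩
  obtain ⟨w, rfl⟩ := Sym2.mem_iff_exists.mp h.2
  exact hx w h.1

end Walk

/-- **Euler's theorem**: a finite connected graph with even degrees has a closed Eulerian trail. -/
theorem Connected.exists_isEulerian {V : Type*} [Fintype V] [DecidableEq V] {G : SimpleGraph V}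
    [DecidableRel G.Adj] (hconn : G.Connected) (heven : ∀ v, Even (G.degree v)) :
    ∃ (u : V) (p : G.Walk u u), p.IsEulerian := by
  obtain ⟨n, ⟨u, v, p, hp, hlen⟩, hmax⟩ :
      ∃ n, (∃ (u v : V) (p : G.Walk u v), p.IsTrail ∧ p.length = n) ∧
        ∀ (u v : V) (q : G.Walk u v), q.IsTrail → q.length ≤ n := by
    classical
    let P : ℕ → Prop := fun n => ∃ (u v : V) (p : G.Walk u v), p.IsTrail ∧ p.length = n
    obtain ⟨u⟩ := hconn.nonempty
    have h0 : P 0 := ⟨u, u, .nil, by simp, rfl⟩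
    refine ⟨Nat.findGreatest P G.edgeFinset.card, Nat.findGreatest_spec (Nat.zero_le _) h0, ?_⟩
    exact fun u v q hq => Nat.le_findGreatest hq.length_le_card_edgeFinset ⟨u, v, q, hq, rfl⟩
  have hsat : ∀ (u v : V) (q : G.Walk u v), q.IsTrail → q.length = n →
      ∀ w, G.Adj u w → s(u, w) ∈ q.edges := by
    intro u v q hq hqn w hw
    by_contra hmem
    have := hmax _ _ (q.cons hw.symm) (by
      rw [Walk.isTrail_cons]
      exact ⟨hq, by rwa [Sym2.eq_swap]⟩)
    rw [Walk.length_cons] at this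
    omega
  obtain rfl : u = v := by
    by_contra huv
    have h := (hp.even_countP_edges_iff u).mp (by
      rw [hp.countP_mem_edges_eq_degree u (hsat _ _ p hp hlen)]
      exact heven u) huv
    exact h.1 rfl
  have hall : ∀ x ∈ p.support, ∀ w, G.Adj x w → s(x, w) ∈ p.edges := by
    intro x hx w hw
    rw [← (p.rotate_edges x hx).mem_iff]
    exact hsat _ _ (p.rotate x hx) (by simpa using hp) (by simpa using hlen) w hw
  have hsupp : ∀ x, x ∈ p.support := by
    intro x
    by_contra hx
    obtain ⟨q⟩ := hconn.preconnected u x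
    obtain ⟨d, -, hd, hd'⟩ := q.exists_boundary_dart {y | y ∈ p.support} p.start_mem_support hx
    exact hd' (p.snd_mem_support_of_mem_edges (hall _ hd _ d.adj))
  refine ⟨u, p, hp.isEulerian_of_forall_mem fun e he => ?_⟩
  induction e with
  | _ a b => exact hall a (hsupp a) b he

end SimpleGraph

namespace subdividedDouble

variable {V : Type*} {G : SimpleGraph V}

theorem adj_inl_inr {v : V} {i : Bool} {e : G.edgeSet} :
    (subdividedDouble G).Adj (Sum.inl (v, i)) (Sum.inr e) ↔ v ∈ (e : Sym2 V) := by
  simp only [subdividedDouble, fromRel_adj]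
  constructor
  · rintro ⟨-, ⟨_, _, _, h, h', hm⟩ | ⟨_, _, _, h, -⟩⟩
    · cases h
      cases h'
      exact hm
    · cases h
  · exact fun h => ⟨Sum.inl_ne_inr, Or.inl ⟨v, i, e, rfl, rfl, h⟩⟩

theorem not_adj_inl_inl {a b : V × Bool} :
    ¬ (subdividedDouble G).Adj (Sum.inl a) (Sum.inl b) := by
  simp [subdividedDouble]

/-- The automorphism exchanging the twins `(v, false)` and `(v, true)` whenever `S v` holds. -/
def swapHom (S : V → Bool) : subdividedDouble G →g subdividedDouble G where
  toFun := Sum.map (fun a => (a.1, a.2 ^^ S a.1)) id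
  map_rel' := by
    rintro (⟨a, i⟩ | e) (⟨b, j⟩ | f) h
    · exact absurd h not_adj_inl_inl
    · exact adj_inl_inr.mpr (adj_inl_inr.mp h)
    · exact (adj_inl_inr.mpr (adj_inl_inr.mp h.symm)).symm
    · simp [subdividedDouble] at h

theorem swapHom_inl (S : V → Bool) (v : V) (i : Bool) :
    swapHom (G := G) S (Sum.inl (v, i)) = Sum.inl (v, i ^^ S v) := rfl

theorem swapHom_inr (S : V → Bool) (e : G.edgeSet) :
    swapHom S (Sum.inr e) = Sum.inr e := rfl

theorem swapHom_involutive (S : V → Bool) : Function.Involutive (swapHom (G := G) S) := by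
  rintro (⟨v, i⟩ | e)
  · simp [swapHom_inl]
  · rfl

theorem mem_edges_map_swapHom {x y : (V × Bool) ⊕ G.edgeSet} (H : (subdividedDouble G).Walk x y)
    (S : V → Bool) (v : V) (i : Bool) (e : G.edgeSet) :
    s(Sum.inl (v, i), Sum.inr e) ∈ (H.map (swapHom S)).edges ↔
      s(Sum.inl (v, i ^^ S v), Sum.inr e) ∈ H.edges := by
  have hinj := Sym2.map.injective (swapHom_involutive (G := G) S).injective
  rw [Walk.edges_map, ← List.mem_map_of_injective hinj (a := s(Sum.inl (v, i ^^ S v), Sum.inr e))]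
  simp [swapHom_inl, swapHom_inr]

variable [DecidableEq V]

/-- A trail of `G` visiting every vertex at most twice after its start lifts to `D(G)`: the last
visit of a vertex passes through its `false` twin, the earlier one through its `true` twin. -/
theorem exists_lift {u v : V} (p : G.Walk u v) (hp : p.IsTrail)
    (hcount : ∀ x, p.support.tail.count x ≤ 2) (i : Bool) (hi : p.Nil → i = false) :
    ∃ q : (subdividedDouble G).Walk (Sum.inl (u, i)) (Sum.inl (v, false)),
      q.support.tail.Nodup ∧
      (∀ e : G.edgeSet, Sum.inr e ∈ q.support.tail ↔ (e : Sym2 V) ∈ p.edges) ∧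
      (∀ x, Sum.inl (x, false) ∈ q.support.tail ↔ x ∈ p.support.tail) ∧
      (∀ x, Sum.inl (x, true) ∈ q.support.tail ↔ 2 ≤ p.support.tail.count x) ∧
      ∀ x j k e, s(Sum.inl (x, j), Sum.inr e) ∈ q.edges →
        s(Sum.inl (x, k), Sum.inr e) ∈ q.edges → j = k := by
  induction p generalizing i with
  | nil =>
    obtain rfl := hi Walk.Nil.nil
    exact ⟨Walk.nil, by simp⟩
  | @cons u v w h p ih =>
    rw [Walk.isTrail_cons] at hp
    have hcount' : ∀ x, (v :: p.support.tail).count x ≤ 2 := by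
      simpa [p.cons_tail_support] using hcount
    obtain ⟨q, hnodup, hedge, hfalse, htrue, huniq⟩ := ih hp.1
      (fun x => (List.count_le_count_cons ..).trans (hcount' x)) (decide (v ∈ p.support.tail))
      (fun hnil => by simp [Walk.nil_iff_support_eq.mp hnil])
    let e : G.edgeSet := ⟨s(u, v), h⟩
    have hue : (subdividedDouble G).Adj (Sum.inl (u, i)) (Sum.inr e) :=
      adj_inl_inr.mpr (Sym2.mem_mk_left u v)
    have hve : (subdividedDouble G).Adj (Sum.inr e)
        (Sum.inl (v, decide (v ∈ p.support.tail))) :=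
      (adj_inl_inr.mpr (Sym2.mem_mk_right u v)).symm
    have he : Sum.inr e ∉ q.support.tail := fun hmem => hp.2 ((hedge e).mp hmem)
    have hv : Sum.inl (v, decide (v ∈ p.support.tail)) ∉ q.support.tail := by
      by_cases hmem : v ∈ p.support.tail
      · have := hcount' v
        rw [List.count_cons_self] at this
        simp only [hmem, decide_true, htrue]
        omega
      · simp [hmem, hfalse]
    have he' : ∀ x j, s(Sum.inl (x, j), Sum.inr e) ∉ q.edges := by
      intro x j hmem
      have := q.snd_mem_support_of_mem_edges hmem
      rw [← q.cons_tail_support] at this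
      simp [he, -Walk.cons_tail_support] at this
    have htail : ((q.cons hve).cons hue).support.tail =
        Sum.inr e :: Sum.inl (v, decide (v ∈ p.support.tail)) :: q.support.tail := by
      simp [q.cons_tail_support]
    have hptail : (p.cons h).support.tail = v :: p.support.tail := by
      simp [p.cons_tail_support]
    refine ⟨(q.cons hve).cons hue, ?_, ?_, ?_, ?_, ?_⟩
    · rw [htail]
      simp [he, hv, hnodup, -Walk.cons_tail_support]
    · intro f
      rw [htail]
      simp [hedge, e, Subtype.ext_iff, -Walk.cons_tail_support]
    · intro x
      rw [htail, hptail]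
      simp only [List.mem_cons, reduceCtorEq, false_or, hfalse, Sum.inl.injEq, Prod.mk.injEq]
      grind
    · intro x
      rw [htail, hptail]
      simp only [List.mem_cons, reduceCtorEq, false_or, htrue, Sum.inl.injEq, Prod.mk.injEq,
        List.count_cons, beq_iff_eq]
      have := List.one_le_count_iff (a := x) (l := p.support.tail)
      have := hcount' x
      grind
    · intro x j k f hj hk
      have hne := h.ne
      simp only [Walk.edges_cons, List.mem_cons, Sym2.eq_iff, Sum.inl.injEq, Sum.inr.injEq,
        reduceCtorEq, Prod.mk.injEq] at hj hk
      by_cases hf : f = e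
      · subst hf
        simp only [he', or_false] at hj hk
        grind
      · exact huniq x j k f (by simpa [hf] using hj) (by simpa [hf] using hk)

variable [Fintype V] [DecidableRel G.Adj]

/-- `D(G)` has a Hamiltonian cycle no edge-vertex of which lies between two twins. -/
theorem exists_isHamiltonianCycle (hconn : G.Connected) (hreg : G.IsRegularOfDegree 4) :
    ∃ (x : (V × Bool) ⊕ G.edgeSet) (H : (subdividedDouble G).Walk x x), H.IsHamiltonianCycle ∧
      ∀ v i j e, s(Sum.inl (v, i), Sum.inr e) ∈ H.edges →
        s(Sum.inl (v, j), Sum.inr e) ∈ H.edges → i = j := by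
  obtain ⟨u, p, hp⟩ := hconn.exists_isEulerian fun v => by rw [hreg v]; decide
  have hcount : ∀ x, p.support.tail.count x = 2 := by
    intro x
    have h := p.countP_mem_edges_add x
    rw [hp.isTrail.countP_mem_edges_eq_degree x fun w hw => hp.mem_edges_iff.mpr hw, hreg x] at h
    omega
  obtain ⟨H, hnodup, hedge, hfalse, htrue, huniq⟩ :=
    exists_lift p hp.isTrail (fun x => (hcount x).le) false fun _ => rfl
  have hmem : ∀ a, a ∈ H.support.tail := by
    rintro (⟨x, _ | _⟩ | e)
    · rw [hfalse, ← List.count_pos_iff, hcount]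
      decide
    · exact (htrue x).mpr (hcount x).ge
    · exact (hedge e).mpr (hp.mem_edges_iff.mpr e.2)
  have hnil : ¬ H.Nil := fun h => by
    simpa [Walk.nil_iff_support_eq.mp h] using hmem (Sum.inl (u, false))
  have hlen : 3 ≤ H.length := by
    obtain ⟨e⟩ : Nonempty G.edgeSet := by
      have : 0 < G.degree u := by rw [hreg u]; decide
      obtain ⟨w, hw⟩ := (G.degree_pos_iff_exists_adj u).mp this
      exact ⟨⟨s(u, w), hw⟩⟩
    have hsub : [Sum.inl (u, false), Sum.inl (u, true), Sum.inr e] ⊆ H.support.tail :=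
      fun a _ => hmem a
    have := (List.subperm_of_subset (by simp) hsub).length_le
    simpa using this
  have htail : H.tail.IsPath := by
    rwa [Walk.isPath_def, Walk.support_tail_of_not_nil _ hnil]
  refine ⟨_, H, ⟨Walk.isCycle_iff_isPath_tail_and_le_length.mpr ⟨htail, hlen⟩, ?_⟩, huniq⟩
  exact htail.isHamiltonian_of_mem fun a => Walk.support_tail_of_not_nil _ hnil ▸ hmem a

end subdividedDouble

/-- A connected 4-regular graph on `n` vertices has at least `2 ^ n` Hamiltonian cycles,
counted as distinct when their edge sets differ. -/
theorem subdividedDouble_two_pow_hamiltonian_cycles {V : Type} [Fintype V] [DecidableEq V]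
    (G : SimpleGraph V) [DecidableRel G.Adj]
    (hconn : G.Connected) (hreg : G.IsRegularOfDegree 4) :
    2 ^ (Fintype.card V) ≤
      {E : Set (Sym2 ((V × Bool) ⊕ ↥G.edgeSet)) |
        ∃ (x : (V × Bool) ⊕ ↥G.edgeSet) (H : (subdividedDouble G).Walk x x),
          H.IsHamiltonianCycle ∧ E = {e | e ∈ H.edges}}.ncard := by
  obtain ⟨x, H, hH, huniq⟩ := subdividedDouble.exists_isHamiltonianCycle hconn hreg
  let F : (V → Bool) → Set (Sym2 ((V × Bool) ⊕ ↥G.edgeSet)) :=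
    fun S => {e | e ∈ (H.map (subdividedDouble.swapHom S)).edges}
  have hinj : Function.Injective F := by
    intro S T hST
    funext v
    have key : ∀ i e, s(Sum.inl (v, i ^^ S v), Sum.inr e) ∈ H.edges ↔
        s(Sum.inl (v, i ^^ T v), Sum.inr e) ∈ H.edges := fun i e => by
      rw [← subdividedDouble.mem_edges_map_swapHom, ← subdividedDouble.mem_edges_map_swapHom]
      exact Set.ext_iff.mp hST s(Sum.inl (v, i), Sum.inr e)
    obtain ⟨f, hf, hvf⟩ := (Walk.mem_support_iff_exists_mem_edges_of_not_nil hH.isCycle.not_nil).mp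
      (hH.mem_support (Sum.inl (v, false ^^ S v)))
    obtain ⟨y, rfl⟩ := Sym2.mem_iff_exists.mp hvf
    rcases y with a | e
    · exact absurd (H.adj_of_mem_edges hf) subdividedDouble.not_adj_inl_inl
    · simpa using huniq _ _ _ _ hf ((key false e).mp hf)
  calc 2 ^ Fintype.card V = (Set.range F).ncard := by
        rw [← Nat.card_coe_set_eq, Nat.card_range_of_injective hinj]
        simp
    _ ≤ _ := by
        refine Set.ncard_le_ncard ?_ (Set.toFinite _)
        rintro _ ⟨S, rfl⟩
        exact ⟨_, H.map (subdividedDouble.swapHom S),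
          hH.map (subdividedDouble.swapHom_involutive S).bijective, rfl⟩
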